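/- Let d = 2 and ε = −1 (plasma case). Let f be a C¹ solution of the two-dimensional Vlasov–Poisson system, compactly supported in (x,v) locally uniformly in t, with total mass M > 0, and let R solve R̈ = 1/R, R(0) = 1, Ṙ(0) = 0. Define L(t) = ∬_{ℝ²×ℝ²} |v − (Ṙ(t)/R(t))x|² f(t,x,v) dv dx + ∫_{ℝ²} U(t,x) ρ(t,x) dx + R(t)^{−2} ∫_{ℝ²} |x|² ρ(t,x) dx + (M²/2π) log R(t). Then dL/dt = −2 (Ṙ(t)/R(t)) ∬_{ℝ²×ℝ²} |v − (Ṙ(t)/R(t))x|² f(t,x,v) dv dx ≤ 0, L is bounded from below (indeed L(t) ≥ (M²/4π)(1 − log(M/2π)) for all t ≥ 0), and ∫_0^∞ (Ṙ(s)/R(s)) ( ∬_{ℝ²×ℝ²} |v − (Ṙ(s)/R(s))x|² f(s,x,v) dv dx ) ds < +∞. -/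

import Mathlib

open MeasureTheory Set Real
open scoped ENNReal Topology BigOperators

noncomputable section

local notation "𝔼" => EuclideanSpace ℝ (Fin 2)

section ParametricIntegral

lemma integrable_mul_of_zero_off_compact {X : Type*} [NormedAddCommGroup X] [MeasurableSpace X]
    [BorelSpace X] {μ : Measure X} {w g : X → ℝ}
    (hw : LocallyIntegrable w μ) (hg : Continuous g) {C : Set X} (hC : IsCompact C)
    (hgC : ∀ x ∉ C, g x = 0) : Integrable (fun x => w x * g x) μ := by
  have hcs : HasCompactSupport g := HasCompactSupport.intro hC hgC
  simpa [smul_eq_mul] using hw.integrable_smul_right_of_hasCompactSupport hg hcs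

lemma deriv_eq_zero_of_zero_on_ball {g : ℝ → ℝ} {t₀ ε s : ℝ}
    (h : ∀ s ∈ Metric.ball t₀ ε, g s = 0) (hs : s ∈ Metric.ball t₀ ε) : deriv g s = 0 := by
  have : g =ᶠ[𝓝 s] fun _ => 0 :=
    Filter.eventually_of_mem (Metric.isOpen_ball.mem_nhds hs) h
  rw [this.deriv_eq]; simp

variable {X : Type*} [NormedAddCommGroup X] [NormedSpace ℝ X]

lemma continuous_partial_deriv {g : ℝ → X → ℝ} (hg : ContDiff ℝ 1 (fun p : ℝ × X => g p.1 p.2)) :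
    Continuous (fun p : ℝ × X => deriv (fun s => g s p.2) p.1) := by
  have h : ∀ p : ℝ × X, deriv (fun s => g s p.2) p.1
      = fderiv ℝ (fun p : ℝ × X => g p.1 p.2) p (1, 0) := by
    intro p
    have h1 : HasFDerivAt (fun p : ℝ × X => g p.1 p.2)
        (fderiv ℝ (fun p : ℝ × X => g p.1 p.2) p) (p.1, p.2) :=
      (hg.differentiable one_ne_zero p).hasFDerivAt
    have h2 : HasDerivAt (fun s : ℝ => (s, p.2)) ((1 : ℝ), (0 : X)) p.1 :=
      (hasDerivAt_id p.1).prodMk (hasDerivAt_const p.1 p.2)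
    exact (h1.comp_hasDerivAt p.1 h2).deriv
  simp_rw [h]
  exact (hg.continuous_fderiv one_ne_zero).clm_apply continuous_const

lemma hasDerivAt_partial {g : ℝ → X → ℝ} (hg : ContDiff ℝ 1 (fun p : ℝ × X => g p.1 p.2))
    (t : ℝ) (x : X) : HasDerivAt (fun s => g s x) (deriv (fun s => g s x) t) t := by
  have h : ContDiff ℝ 1 (fun s => g s x) :=
    hg.comp (contDiff_id.prodMk contDiff_const)
  exact (h.differentiable one_ne_zero t).hasDerivAt

variable [MeasurableSpace X] [BorelSpace X] [SecondCountableTopology X]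

/-- Differentiation under the integral sign, for a `C¹` integrand with locally uniform compact
support against a locally integrable weight. -/
lemma hasDerivAt_integral_weight_mul {μ : Measure X} {w : X → ℝ} {g : ℝ → X → ℝ}
    (hw : LocallyIntegrable w μ) (hg : ContDiff ℝ 1 (fun p : ℝ × X => g p.1 p.2))
    {C : Set X} (hC : IsCompact C) {t₀ ε : ℝ} (hε : 0 < ε)
    (hgC : ∀ s ∈ Metric.ball t₀ ε, ∀ x ∉ C, g s x = 0) :
    HasDerivAt (fun s => ∫ x, w x * g s x ∂μ)
      (∫ x, w x * deriv (fun s => g s x) t₀ ∂μ) t₀ := by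
  have hgc : ∀ s, Continuous (g s) := fun s =>
    hg.continuous.comp (continuous_const.prodMk continuous_id)
  have hdc := continuous_partial_deriv hg
  obtain ⟨B, hB⟩ := ((isCompact_closedBall t₀ (ε / 2)).prod hC).exists_bound_of_continuousOn
    hdc.continuousOn
  have hsub : Metric.ball t₀ (ε / 2) ⊆ Metric.ball t₀ ε := Metric.ball_subset_ball (by linarith)
  refine (hasDerivAt_integral_of_dominated_loc_of_deriv_le (s := Metric.ball t₀ (ε / 2))
    (bound := C.indicator (fun x => ‖w x‖ * |B|)) (F := fun s x => w x * g s x)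
    (F' := fun s x => w x * deriv (fun s => g s x) s)
    (Metric.ball_mem_nhds _ (by positivity)) ?_ ?_ ?_ ?_ ?_ ?_).2
  · exact Filter.Eventually.of_forall fun s =>
      hw.aestronglyMeasurable.mul (hgc s).aestronglyMeasurable
  · exact integrable_mul_of_zero_off_compact hw (hgc t₀) hC (hgC t₀ (Metric.mem_ball_self hε))
  · refine hw.aestronglyMeasurable.mul (Continuous.aestronglyMeasurable ?_)
    exact hdc.comp (continuous_const.prodMk continuous_id)
  · refine Filter.Eventually.of_forall fun x s hs => ?_
    by_cases hx : x ∈ C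
    · rw [indicator_of_mem hx, norm_mul]
      gcongr
      exact (hB (s, x) ⟨Metric.ball_subset_closedBall hs, hx⟩).trans (le_abs_self B)
    · rw [deriv_eq_zero_of_zero_on_ball (fun s hs => hgC s hs x hx) (hsub hs)]
      simp [hx]
  · rw [integrable_indicator_iff hC.measurableSet]
    exact ((hw.integrableOn_isCompact hC).norm).mul_const _
  · exact Filter.Eventually.of_forall fun x s _ => (hasDerivAt_partial hg s x).const_mul _

end ParametricIntegral

section LogKernel

lemma locallyIntegrable_log_norm : LocallyIntegrable (fun x : 𝔼 => Real.log ‖x‖) := by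
  rw [locallyIntegrable_iff]
  intro k hk
  obtain ⟨r, hr⟩ := hk.isBounded.subset_ball 0
  refine IntegrableOn.mono_set ?_ hr
  rw [← integrable_indicator_iff measurableSet_ball]
  have h1 : (Metric.ball (0 : 𝔼) r).indicator (fun x : 𝔼 => Real.log ‖x‖)
      = fun x => (Iio r).indicator Real.log ‖x‖ := by
    ext x
    by_cases hx : ‖x‖ < r <;> simp [indicator, hx]
  rw [h1, integrable_fun_norm_addHaar]
  have h2 : (fun y : ℝ => y ^ (Module.finrank ℝ 𝔼 - 1) • (Iio r).indicator Real.log y)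
      = (Iio r).indicator (fun y => y * Real.log y) := by
    ext y
    by_cases hy : y < r <;> simp [indicator, hy]
  rw [h2, IntegrableOn, integrable_indicator_iff measurableSet_Iio, IntegrableOn,
    Measure.restrict_restrict measurableSet_Iio]
  have h3 : IntegrableOn (fun y : ℝ => y * Real.log y) (Icc 0 r) :=
    Real.continuous_mul_log.continuousOn.integrableOn_Icc
  exact h3.mono_set fun y hy => ⟨(mem_Ioi.1 hy.2).le, (mem_Iio.1 hy.1).le⟩

lemma locallyIntegrable_log_norm_sub :
    LocallyIntegrable (fun p : 𝔼 × 𝔼 => Real.log ‖p.1 - p.2‖) := by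
  rw [locallyIntegrable_iff]
  intro k hk
  obtain ⟨r, hr⟩ := hk.isBounded.subset_closedBall 0
  refine IntegrableOn.mono_set ?_ hr
  have h1 : Integrable ((Metric.closedBall (0 : 𝔼) r).indicator fun _ => (1 : ℝ)) :=
    (integrable_indicator_iff measurableSet_closedBall).2
      (integrableOn_const measure_closedBall_lt_top.ne)
  have h2 : Integrable ((Metric.closedBall (0 : 𝔼) (2 * r)).indicator
      fun x => Real.log ‖x‖) :=
    (integrable_indicator_iff measurableSet_closedBall).2
      (locallyIntegrable_log_norm.integrableOn_isCompact (isCompact_closedBall _ _))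
  have h3 := h1.convolution_integrand (ContinuousLinearMap.mul ℝ ℝ) h2
  refine (h3.integrableOn (s := Metric.closedBall 0 r)).congr_fun ?_ measurableSet_closedBall
  intro p hp
  have hp' : ‖p.1‖ ≤ r ∧ ‖p.2‖ ≤ r := by
    simpa [Prod.norm_def] using hp
  have h4 : ‖p.1 - p.2‖ ≤ 2 * r := (norm_sub_le _ _).trans (by linarith)
  simp [indicator, hp'.2, h4]

end LogKernel

section Transport

lemma integrable_of_zero_off_compact {X : Type*} [TopologicalSpace X] [T2Space X]
    [MeasurableSpace X] [OpensMeasurableSpace X] {μ : Measure X}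
    [IsFiniteMeasureOnCompacts μ] {g : X → ℝ} (hg : Continuous g) {C : Set X} (hC : IsCompact C)
    (hgC : ∀ x ∉ C, g x = 0) : Integrable g μ :=
  hg.integrable_of_hasCompactSupport (HasCompactSupport.intro hC hgC)

lemma fderiv_eq_zero_of_notMem_tsupport {X : Type*} [NormedAddCommGroup X] [NormedSpace ℝ X]
    {g : X → ℝ} {x : X} (hx : x ∉ tsupport g) : fderiv ℝ g x = 0 := by
  by_contra h
  exact hx (support_fderiv_subset ℝ (Function.mem_support.2 h))

lemma integral_fderiv_apply_eq_zero {h : 𝔼 → ℝ} (hh : ContDiff ℝ 1 h) (hc : HasCompactSupport h)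
    (v : 𝔼) : ∫ x, fderiv ℝ h x v = 0 := by
  have hd : Integrable (fun x => fderiv ℝ h x v) :=
    integrable_of_zero_off_compact ((hh.continuous_fderiv one_ne_zero).clm_apply continuous_const)
      hc.isCompact fun x hx => by simp [fderiv_eq_zero_of_notMem_tsupport hx]
  have := integral_mul_fderiv_eq_neg_fderiv_mul_of_integrable (μ := (volume : Measure 𝔼))
    (f := fun _ : 𝔼 => (1 : ℝ)) (g := h) (v := v) (by simp) (by simpa using hd)
    (by simpa using hh.continuous.integrable_of_hasCompactSupport hc)
    (fun x _ => differentiableAt_const _) (fun x _ => hh.differentiable one_ne_zero x)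
  simpa using this

lemma integral_fderiv_transport_eq_zero {g : 𝔼 × 𝔼 → ℝ} (hg : ContDiff ℝ 1 g)
    (hc : HasCompactSupport g) {u : 𝔼 → 𝔼} (hu : Continuous u) :
    ∫ p : 𝔼 × 𝔼, fderiv ℝ g p (p.2, -u p.1) = 0 := by
  have hgc := hg.continuous_fderiv one_ne_zero
  have hi1 : Integrable (fun p : 𝔼 × 𝔼 => fderiv ℝ g p (p.2, 0)) :=
    integrable_of_zero_off_compact (hgc.clm_apply (by fun_prop)) hc.isCompact
      fun x hx => by simp [fderiv_eq_zero_of_notMem_tsupport hx]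
  have hi2 : Integrable (fun p : 𝔼 × 𝔼 => fderiv ℝ g p (0, -u p.1)) :=
    integrable_of_zero_off_compact (hgc.clm_apply (by fun_prop)) hc.isCompact
      fun x hx => by simp [fderiv_eq_zero_of_notMem_tsupport hx]
  have hsplit : ∀ p : 𝔼 × 𝔼, fderiv ℝ g p (p.2, -u p.1)
      = fderiv ℝ g p (p.2, 0) + fderiv ℝ g p (0, -u p.1) := by
    intro p
    rw [← map_add]
    simp
  have hd := hg.differentiable one_ne_zero
  have hk : IsCompact (Set.image Prod.fst (tsupport g)) := hc.isCompact.image continuous_fst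
  have hk' : IsCompact (Set.image Prod.snd (tsupport g)) := hc.isCompact.image continuous_snd
  have e1 : ∫ p : 𝔼 × 𝔼, fderiv ℝ g p (p.2, 0) = 0 := by
    rw [Measure.volume_eq_prod] at hi1 ⊢
    rw [integral_prod_symm _ hi1]
    refine integral_eq_zero_of_ae (Filter.Eventually.of_forall fun v => ?_)
    have hgv : ContDiff ℝ 1 (fun x => g (x, v)) := hg.comp (contDiff_id.prodMk contDiff_const)
    have hcv : HasCompactSupport (fun x => g (x, v)) :=
      HasCompactSupport.intro hk fun x hx => image_eq_zero_of_notMem_tsupport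
        fun h => hx ⟨_, h, rfl⟩
    refine Eq.trans ?_ (integral_fderiv_apply_eq_zero hgv hcv v)
    refine integral_congr_ae (Filter.Eventually.of_forall fun x => ?_)
    have h2 : HasFDerivAt (fun x : 𝔼 => (x, v)) (ContinuousLinearMap.inl ℝ 𝔼 𝔼) x :=
      hasFDerivAt_prodMk_left x v
    have h3 := (hd (x, v)).hasFDerivAt.comp x h2
    have h4 : fderiv ℝ (fun x => g (x, v)) x = _ := h3.fderiv
    simp [h4]
  have e2 : ∫ p : 𝔼 × 𝔼, fderiv ℝ g p (0, -u p.1) = 0 := by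
    rw [Measure.volume_eq_prod] at hi2 ⊢
    rw [integral_prod _ hi2]
    refine integral_eq_zero_of_ae (Filter.Eventually.of_forall fun x => ?_)
    have hgv : ContDiff ℝ 1 (fun v => g (x, v)) := hg.comp (contDiff_const.prodMk contDiff_id)
    have hcv : HasCompactSupport (fun v => g (x, v)) :=
      HasCompactSupport.intro hk' fun v hv => image_eq_zero_of_notMem_tsupport
        fun h => hv ⟨_, h, rfl⟩
    refine Eq.trans ?_ (integral_fderiv_apply_eq_zero hgv hcv (-u x))
    refine integral_congr_ae (Filter.Eventually.of_forall fun v => ?_)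
    have h2 : HasFDerivAt (fun v : 𝔼 => (x, v)) (ContinuousLinearMap.inr ℝ 𝔼 𝔼) v :=
      hasFDerivAt_prodMk_right x v
    have h3 := (hd (x, v)).hasFDerivAt.comp v h2
    have h4 : fderiv ℝ (fun v => g (x, v)) v = _ := h3.fderiv
    simp [h4]
  simp_rw [hsplit]
  rw [integral_add hi1 hi2, e1, e2, add_zero]

lemma integral_mul_fderiv_transport {φ F : 𝔼 × 𝔼 → ℝ} (hφ : ContDiff ℝ 1 φ)
    (hF : ContDiff ℝ 1 F) (hc : HasCompactSupport F) {u : 𝔼 → 𝔼} (hu : Continuous u) :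
    ∫ p : 𝔼 × 𝔼, φ p * fderiv ℝ F p (p.2, -u p.1)
      = -∫ p : 𝔼 × 𝔼, fderiv ℝ φ p (p.2, -u p.1) * F p := by
  have h0 := integral_fderiv_transport_eq_zero (hφ.mul hF) (hc.mul_left (f := φ)) hu
  have hv : Continuous (fun p : 𝔼 × 𝔼 => (p.2, -u p.1)) := by fun_prop
  have hi1 : Integrable (fun p : 𝔼 × 𝔼 => φ p * fderiv ℝ F p (p.2, -u p.1)) :=
    integrable_of_zero_off_compact
      (hφ.continuous.mul ((hF.continuous_fderiv one_ne_zero).clm_apply hv)) hc.isCompact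
      fun x hx => by simp [fderiv_eq_zero_of_notMem_tsupport hx]
  have hi2 : Integrable (fun p : 𝔼 × 𝔼 => fderiv ℝ φ p (p.2, -u p.1) * F p) :=
    integrable_of_zero_off_compact
      (((hφ.continuous_fderiv one_ne_zero).clm_apply hv).mul hF.continuous) hc.isCompact
      fun x hx => by simp [image_eq_zero_of_notMem_tsupport hx]
  have hsplit : ∀ p : 𝔼 × 𝔼, fderiv ℝ (φ * F) p (p.2, -u p.1)
      = φ p * fderiv ℝ F p (p.2, -u p.1) + fderiv ℝ φ p (p.2, -u p.1) * F p := by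
    intro p
    rw [fderiv_mul (hφ.differentiable one_ne_zero p) (hF.differentiable one_ne_zero p)]
    simp [mul_comm]
  have h1 : ∫ p : 𝔼 × 𝔼, fderiv ℝ (φ * F) p (p.2, -u p.1) = 0 := h0
  simp_rw [hsplit] at h1
  rw [integral_add hi1 hi2] at h1
  linarith

end Transport

section LogPotential

/-- The logarithmic potential of a planar charge density. -/
def logPotential (r : 𝔼 → ℝ) (x : 𝔼) : ℝ :=
  -(1 / (2 * π)) * ∫ y, Real.log ‖x - y‖ * r y

lemma contDiff_logPotential {r : 𝔼 → ℝ} (hr : ContDiff ℝ 1 r) (hc : HasCompactSupport r) :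
    ContDiff ℝ 1 (logPotential r) := by
  have h := hc.contDiff_convolution_right (n := 1) (ContinuousLinearMap.mul ℝ ℝ)
    locallyIntegrable_log_norm hr
  have e : (fun x => ∫ y, Real.log ‖x - y‖ * r y)
      = convolution (fun x => Real.log ‖x‖) r (ContinuousLinearMap.mul ℝ ℝ) volume := by
    ext x
    rw [convolution_def, ← integral_sub_left_eq_self _ _ x]
    simp
  exact contDiff_const.mul (e ▸ h)

lemma integrable_log_norm_sub_mul {r : 𝔼 → ℝ} (hr : Continuous r) (hc : HasCompactSupport r)
    (x : 𝔼) : Integrable (fun y => Real.log ‖x - y‖ * r y) := by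
  have h := integrable_mul_of_zero_off_compact (μ := volume) (g := fun z => r (x - z))
    locallyIntegrable_log_norm (by fun_prop) (hc.isCompact.image (f := fun y => x - y) (by fun_prop))
    (fun z hz => image_eq_zero_of_notMem_tsupport fun h => hz ⟨_, h, by simp⟩)
  have h2 := h.comp_sub_left x
  simpa using h2

lemma integrable_log_norm_sub_mul_mul {g h : 𝔼 → ℝ} (hg : Continuous g) (hh : Continuous h)
    {C : Set 𝔼} (hC : IsCompact C) (hgC : ∀ x ∉ C, g x = 0) (hhC : ∀ x ∉ C, h x = 0) :
    Integrable (fun p : 𝔼 × 𝔼 => Real.log ‖p.1 - p.2‖ * (h p.1 * g p.2)) := by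
  refine integrable_mul_of_zero_off_compact locallyIntegrable_log_norm_sub (by fun_prop)
    (hC.prod hC) fun p hp => ?_
  by_cases h1 : p.1 ∈ C
  · rw [hgC p.2 fun h2 => hp ⟨h1, h2⟩, mul_zero]
  · rw [hhC _ h1, zero_mul]

lemma integral_logPotential_mul {g h : 𝔼 → ℝ} (hg : Continuous g) (hh : Continuous h)
    {C : Set 𝔼} (hC : IsCompact C) (hgC : ∀ x ∉ C, g x = 0) (hhC : ∀ x ∉ C, h x = 0) :
    ∫ x, logPotential g x * h x
      = -(1 / (2 * π)) * ∫ p : 𝔼 × 𝔼, Real.log ‖p.1 - p.2‖ * (h p.1 * g p.2) := by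
  have hi := integrable_log_norm_sub_mul_mul hg hh hC hgC hhC
  rw [Measure.volume_eq_prod] at hi ⊢
  rw [integral_prod _ hi, ← integral_const_mul]
  refine integral_congr_ae (Filter.Eventually.of_forall fun x => ?_)
  simp only [logPotential]
  rw [mul_assoc, ← integral_mul_const]
  congr 2
  ext y
  ring

/-- Differentiation of the self-interaction energy along a `C¹` family of densities. -/
lemma hasDerivAt_integral_logPotential_mul {σ : ℝ → 𝔼 → ℝ}
    (hσ : ContDiff ℝ 1 (fun p : ℝ × 𝔼 => σ p.1 p.2)) {C : Set 𝔼} (hC : IsCompact C)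
    {t₀ ε : ℝ} (hε : 0 < ε) (hσC : ∀ s ∈ Metric.ball t₀ ε, ∀ x ∉ C, σ s x = 0) :
    HasDerivAt (fun s => ∫ x, logPotential (σ s) x * σ s x)
      (2 * ∫ x, logPotential (σ t₀) x * deriv (fun s => σ s x) t₀) t₀ := by
  have hσc : ∀ s, Continuous (σ s) := fun s =>
    hσ.continuous.comp (continuous_const.prodMk continuous_id)
  have hdc : Continuous (fun x => deriv (fun s => σ s x) t₀) :=
    (continuous_partial_deriv hσ).comp (continuous_const.prodMk continuous_id)
  have ht₀ : t₀ ∈ Metric.ball t₀ ε := Metric.mem_ball_self hε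
  have hdC : ∀ x ∉ C, deriv (fun s => σ s x) t₀ = 0 := fun x hx =>
    deriv_eq_zero_of_zero_on_ball (fun s hs => hσC s hs x hx) ht₀
  have hg : ContDiff ℝ 1 (fun p : ℝ × 𝔼 × 𝔼 => σ p.1 p.2.1 * σ p.1 p.2.2) :=
    (hσ.comp (contDiff_fst.prodMk (contDiff_fst.comp contDiff_snd))).mul
      (hσ.comp (contDiff_fst.prodMk (contDiff_snd.comp contDiff_snd)))
  have key := hasDerivAt_integral_weight_mul (μ := volume)
    (g := fun s (p : 𝔼 × 𝔼) => σ s p.1 * σ s p.2)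
    locallyIntegrable_log_norm_sub hg (hC.prod hC) hε (fun s hs p hp => by
      by_cases h1 : p.1 ∈ C
      · rw [hσC s hs p.2 fun h2 => hp ⟨h1, h2⟩, mul_zero]
      · rw [hσC s hs _ h1, zero_mul])
  have key2 := key.const_mul (-(1 / (2 * π)))
  have heq : (fun s => ∫ x, logPotential (σ s) x * σ s x) =ᶠ[𝓝 t₀]
      fun s => -(1 / (2 * π)) * ∫ p : 𝔼 × 𝔼, Real.log ‖p.1 - p.2‖ * (σ s p.1 * σ s p.2) :=
    Filter.eventually_of_mem (Metric.ball_mem_nhds t₀ hε) fun s hs =>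
      integral_logPotential_mul (hσc s) (hσc s) hC (hσC s hs) (hσC s hs)
  refine (key2.congr_of_eventuallyEq heq).congr_deriv ?_
  have hd : ∀ p : 𝔼 × 𝔼, deriv (fun s => σ s p.1 * σ s p.2) t₀
      = deriv (fun s => σ s p.1) t₀ * σ t₀ p.2 + σ t₀ p.1 * deriv (fun s => σ s p.2) t₀ :=
    fun p => ((hasDerivAt_partial hσ t₀ p.1).mul (hasDerivAt_partial hσ t₀ p.2)).deriv
  have i1 := integrable_log_norm_sub_mul_mul (hσc t₀) hdc hC (hσC t₀ ht₀) hdC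
  have i2 := integrable_log_norm_sub_mul_mul hdc (hσc t₀) hC hdC (hσC t₀ ht₀)
  have hswap : ∫ p : 𝔼 × 𝔼, Real.log ‖p.1 - p.2‖ * (σ t₀ p.1 * deriv (fun s => σ s p.2) t₀)
      = ∫ p : 𝔼 × 𝔼, Real.log ‖p.1 - p.2‖ * (deriv (fun s => σ s p.1) t₀ * σ t₀ p.2) := by
    rw [Measure.volume_eq_prod, ← integral_prod_swap]
    refine integral_congr_ae (Filter.Eventually.of_forall fun p => ?_)
    simp only [Prod.fst_swap, Prod.snd_swap]
    rw [norm_sub_rev]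
    ring
  simp_rw [hd, mul_add]
  rw [integral_add i1 i2, hswap,
    integral_logPotential_mul (hσc t₀) hdc hC (hσC t₀ ht₀) hdC]
  ring

end LogPotential

section Virial

lemma logPotential_scaling {r : 𝔼 → ℝ} (hr : Continuous r) (hc : HasCompactSupport r)
    (s : ℝ) (x : 𝔼) :
    logPotential (fun y => Real.exp s ^ 2 * r (Real.exp s • y)) x
      = logPotential r (Real.exp s • x) + s / (2 * π) * ∫ y, r y := by
  have hi := integrable_log_norm_sub_mul hr hc (Real.exp s • x)
  have hir : Integrable r := hr.integrable_of_hasCompactSupport hc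
  have h1 : ∫ y, Real.log ‖x - y‖ * (Real.exp s ^ 2 * r (Real.exp s • y))
      = ∫ y, Real.log ‖x - Real.exp (-s) • y‖ * r y := by
    have h := Measure.integral_comp_smul (volume : Measure 𝔼)
      (fun y => Real.log ‖x - Real.exp (-s) • y‖ * r y) (Real.exp s)
    simp only [smul_smul, ← Real.exp_add, neg_add_cancel, Real.exp_zero, one_smul,
      finrank_euclideanSpace_fin, smul_eq_mul] at h
    have h2 : |(Real.exp s ^ 2)⁻¹| = (Real.exp s ^ 2)⁻¹ := abs_of_pos (by positivity)
    rw [h2] at h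
    have h3 : Real.exp s ^ 2 ≠ 0 := by positivity
    calc ∫ y, Real.log ‖x - y‖ * (Real.exp s ^ 2 * r (Real.exp s • y))
        = Real.exp s ^ 2 * ∫ y, Real.log ‖x - y‖ * r (Real.exp s • y) := by
          rw [← integral_const_mul]
          congr 1; ext y; ring
      _ = _ := by rw [h, ← mul_assoc, mul_inv_cancel₀ h3, one_mul]
  have h2 : ∫ y, Real.log ‖x - Real.exp (-s) • y‖ * r y
      = ∫ y, (Real.log ‖Real.exp s • x - y‖ * r y - s * r y) := by
    have hne : ∀ᵐ y : 𝔼, y ≠ Real.exp s • x := by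
      simp [ae_iff, measure_singleton]
    refine integral_congr_ae (hne.mono fun y hy => ?_)
    have h3 : x - Real.exp (-s) • y = Real.exp (-s) • (Real.exp s • x - y) := by
      rw [smul_sub, smul_smul, ← Real.exp_add, neg_add_cancel, Real.exp_zero, one_smul]
    have h4 : ‖Real.exp s • x - y‖ ≠ 0 := norm_ne_zero_iff.2 (sub_ne_zero.2 hy.symm)
    simp only
    rw [h3, norm_smul, Real.norm_of_nonneg (Real.exp_pos _).le,
      Real.log_mul (Real.exp_pos _).ne' h4, Real.log_exp]
    ring
  simp only [logPotential]
  rw [h1, h2, integral_sub hi (hir.const_mul s), integral_const_mul]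
  ring

/-- Virial identity for the planar logarithmic potential. -/
lemma integral_fderiv_logPotential_self_mul {r : 𝔼 → ℝ} (hr : ContDiff ℝ 1 r)
    (hc : HasCompactSupport r) :
    ∫ x, fderiv ℝ (logPotential r) x x * r x = -((∫ x, r x) ^ 2 / (4 * π)) := by
  have hV := contDiff_logPotential hr hc
  set V := logPotential r with hVdef
  have hrc := hr.continuous
  set m := ∫ x, r x with hm
  obtain ⟨K, hK⟩ := hc.isCompact.isBounded.subset_closedBall 0
  let C := Metric.closedBall (0 : 𝔼) (Real.exp 1 * |K|)
  have hC : IsCompact C := isCompact_closedBall _ _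
  let σ : ℝ → 𝔼 → ℝ := fun s x => Real.exp s ^ 2 * r (Real.exp s • x)
  have hσ : ContDiff ℝ 1 (fun p : ℝ × 𝔼 => σ p.1 p.2) := by
    have he : ContDiff ℝ 1 (fun p : ℝ × 𝔼 => Real.exp p.1) := Real.contDiff_exp.comp contDiff_fst
    exact (he.pow 2).mul (hr.comp (he.smul contDiff_snd))
  have hrC : ∀ x ∉ C, r x = 0 := by
    intro x hx
    refine image_eq_zero_of_notMem_tsupport fun h => hx ?_
    have h1 : ‖x‖ ≤ K := by simpa using hK h
    have h2 : (1 : ℝ) ≤ Real.exp 1 := Real.one_le_exp zero_le_one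
    simp only [C, mem_closedBall_zero_iff]
    calc ‖x‖ ≤ |K| := h1.trans (le_abs_self K)
      _ ≤ Real.exp 1 * |K| := le_mul_of_one_le_left (abs_nonneg K) h2
  have hσC : ∀ s ∈ Metric.ball (0 : ℝ) 1, ∀ x ∉ C, σ s x = 0 := by
    intro s hs x hx
    have hs' : -1 < s := by
      have := Metric.mem_ball.1 hs
      rw [Real.dist_eq, sub_zero] at this
      exact (abs_lt.1 this).1
    have : r (Real.exp s • x) = 0 := by
      refine image_eq_zero_of_notMem_tsupport fun h => hx ?_
      have h1 : Real.exp s * ‖x‖ ≤ K := by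
        have := hK h
        rwa [mem_closedBall_zero_iff, norm_smul, Real.norm_of_nonneg (Real.exp_pos _).le] at this
      simp only [C, mem_closedBall_zero_iff]
      calc ‖x‖ = Real.exp (-s) * (Real.exp s * ‖x‖) := by
            rw [← mul_assoc, ← Real.exp_add]; simp
        _ ≤ Real.exp 1 * |K| := by
            gcongr
            · linarith
            · exact h1.trans (le_abs_self K)
    simp [σ, this]
  have hσ0 : σ 0 = r := by ext x; simp [σ]
  have scale : ∀ (s : ℝ) (g : 𝔼 → ℝ), ∫ x, g x * σ s x = ∫ x, g (Real.exp (-s) • x) * r x := by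
    intro s g
    have h := Measure.integral_comp_smul (volume : Measure 𝔼)
      (fun y => g (Real.exp (-s) • y) * r y) (Real.exp s)
    simp only [smul_smul, ← Real.exp_add, neg_add_cancel, Real.exp_zero, one_smul,
      finrank_euclideanSpace_fin, smul_eq_mul] at h
    have h2 : |(Real.exp s ^ 2)⁻¹| = (Real.exp s ^ 2)⁻¹ := abs_of_pos (by positivity)
    rw [h2] at h
    have h3 : Real.exp s ^ 2 ≠ 0 := by positivity
    calc ∫ x, g x * σ s x
        = Real.exp s ^ 2 * ∫ y, g y * r (Real.exp s • y) := by
          rw [← integral_const_mul]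
          congr 1; ext y; simp only [σ]; ring
      _ = _ := by rw [h, ← mul_assoc, mul_inv_cancel₀ h3, one_mul]
  have hir : Integrable r := hrc.integrable_of_hasCompactSupport hc
  have hiVr : Integrable (fun x => V x * r x) :=
    (hV.continuous.mul hrc).integrable_of_hasCompactSupport hc.mul_left
  have energy : ∀ s, ∫ x, logPotential (σ s) x * σ s x
      = (∫ x, V x * r x) + s * (m ^ 2 / (2 * π)) := by
    intro s
    rw [scale]
    have : ∀ x, logPotential (σ s) (Real.exp (-s) • x) * r x
        = V x * r x + s / (2 * π) * m * r x := by
      intro x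
      simp only [σ]
      rw [logPotential_scaling hrc hc, smul_smul, ← Real.exp_add]
      simp [hVdef, hm, add_mul]
    simp_rw [this]
    rw [integral_add hiVr (hir.const_mul _), integral_const_mul, ← hm]
    ring
  have d1 := hasDerivAt_integral_logPotential_mul hσ hC one_pos hσC
  simp_rw [energy, hσ0] at d1
  have d2 : HasDerivAt (fun s : ℝ => (∫ x, V x * r x) + s * (m ^ 2 / (2 * π)))
      (m ^ 2 / (2 * π)) 0 := by
    simpa using ((hasDerivAt_id (0 : ℝ)).mul_const (m ^ 2 / (2 * π))).const_add (∫ x, V x * r x)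
  have e1 := d1.unique d2
  have d3 := hasDerivAt_integral_weight_mul (μ := volume) (w := V) (g := σ)
    hV.continuous.locallyIntegrable hσ hC one_pos hσC
  simp_rw [scale] at d3
  have hg : ContDiff ℝ 1 (fun p : ℝ × 𝔼 => V (Real.exp (-p.1) • p.2)) := by
    have he : ContDiff ℝ 1 (fun p : ℝ × 𝔼 => Real.exp (-p.1)) :=
      Real.contDiff_exp.comp contDiff_fst.neg
    exact hV.comp (he.smul contDiff_snd)
  have d4 := hasDerivAt_integral_weight_mul (μ := (volume : Measure 𝔼)) (w := fun _ => (1 : ℝ))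
    (g := fun s x => V (Real.exp (-s) • x) * r x) (t₀ := 0)
    continuous_const.locallyIntegrable (hg.mul (hr.comp contDiff_snd)) hC one_pos
    (fun s _ x hx => by rw [hrC x hx, mul_zero])
  simp_rw [one_mul] at d4
  have e2 := d3.unique d4
  have hd : ∀ x, deriv (fun s => V (Real.exp (-s) • x) * r x) 0 = -(fderiv ℝ V x x * r x) := by
    intro x
    have h1 : HasDerivAt (fun s : ℝ => Real.exp (-s) • x) (-x) 0 := by
      have h := ((hasDerivAt_neg (0 : ℝ)).exp).smul_const x
      simpa using h
    have h2 : HasFDerivAt V (fderiv ℝ V x) (Real.exp (-(0 : ℝ)) • x) := by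
      simpa using (hV.differentiable one_ne_zero x).hasFDerivAt
    have h3 := (h2.comp_hasDerivAt 0 h1).mul_const (r x)
    have h4 := h3.deriv
    simpa using h4
  simp_rw [hd] at e2
  rw [integral_neg] at e2
  rw [e2] at e1
  have : m ^ 2 / (4 * π) = m ^ 2 / (2 * π) / 2 := by
    rw [div_div]; congr 1; ring
  rw [this]
  linarith

end Virial

section Moments

lemma continuous_gradient {V : 𝔼 → ℝ} (hV : ContDiff ℝ 1 V) : Continuous (gradient V) :=
  (InnerProductSpace.toDual ℝ 𝔼).symm.continuous.comp (hV.continuous_fderiv one_ne_zero)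

lemma contDiff_integral_velocity {f : ℝ → 𝔼 → 𝔼 → ℝ}
    (hf : ContDiff ℝ 1 (fun p : ℝ × 𝔼 × 𝔼 => f p.1 p.2.1 p.2.2)) {C : Set 𝔼} (hC : IsCompact C)
    (hfC : ∀ t x, ∀ v ∉ C, f t x v = 0) :
    ContDiff ℝ 1 (fun p : ℝ × 𝔼 => ∫ v, f p.1 p.2 v) := by
  have h := contDiffOn_convolution_right_with_param (n := 1) (μ := (volume : Measure 𝔼))
    (f := fun _ : 𝔼 => (1 : ℝ)) (ContinuousLinearMap.mul ℝ ℝ)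
    (g := fun (p : ℝ × 𝔼) v => f p.1 p.2 v) isOpen_univ hC
    (fun p v _ hv => hfC p.1 p.2 v hv) continuous_const.locallyIntegrable
    (hf.comp (f := fun q : (ℝ × 𝔼) × 𝔼 => (q.1.1, q.1.2, q.2))
      (by fun_prop)).contDiffOn
  rw [univ_prod_univ, contDiffOn_univ] at h
  have h2 := h.comp (f := fun p : ℝ × 𝔼 => (p, (0 : 𝔼))) (contDiff_id.prodMk contDiff_const)
  have e : (fun p : ℝ × 𝔼 => ∫ v, f p.1 p.2 v) = (fun q : (ℝ × 𝔼) × 𝔼 =>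
      convolution (fun _ : 𝔼 => (1 : ℝ)) (fun v => f q.1.1 q.1.2 v)
        (ContinuousLinearMap.mul ℝ ℝ) volume q.2) ∘ fun p => (p, (0 : 𝔼)) := by
    ext p
    simp only [Function.comp, convolution_def, ContinuousLinearMap.mul_apply', one_mul]
    rw [integral_sub_left_eq_self (fun v => f p.1 p.2 v)]
  rw [e]
  exact h2

variable {f : ℝ → 𝔼 → 𝔼 → ℝ} {C : Set 𝔼} {t₀ : ℝ}

lemma integral_mul_integral_velocity {g : 𝔼 → 𝔼 → ℝ} (hg : Continuous fun p : 𝔼 × 𝔼 => g p.1 p.2)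
    (hC : IsCompact C) (hgC : ∀ x v, x ∉ C ∨ v ∉ C → g x v = 0) {φ : 𝔼 → ℝ} (hφ : Continuous φ) :
    ∫ x, φ x * ∫ v, g x v = ∫ p : 𝔼 × 𝔼, φ p.1 * g p.1 p.2 := by
  have hi : Integrable (fun p : 𝔼 × 𝔼 => φ p.1 * g p.1 p.2) :=
    integrable_of_zero_off_compact (by fun_prop) (hC.prod hC) fun p hp => by
      rw [hgC _ _ (not_and_or.1 hp), mul_zero]
  rw [Measure.volume_eq_prod] at hi ⊢
  rw [integral_prod _ hi]
  refine integral_congr_ae (Filter.Eventually.of_forall fun x => ?_)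
  exact (integral_const_mul _ _).symm

lemma fderiv_phase_apply {F : 𝔼 × 𝔼 → ℝ} {p : 𝔼 × 𝔼} (hF : DifferentiableAt ℝ F p) (a b : 𝔼) :
    fderiv ℝ F p (a, b)
      = fderiv ℝ (fun y => F (y, p.2)) p.1 a + fderiv ℝ (fun w => F (p.1, w)) p.2 b := by
  have h1 : fderiv ℝ (fun y => F (y, p.2)) p.1 = _ :=
    (HasFDerivAt.comp (g := F) p.1 hF.hasFDerivAt (hasFDerivAt_prodMk_left p.1 p.2)).fderiv
  have h2 : fderiv ℝ (fun w => F (p.1, w)) p.2 = _ :=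
    (HasFDerivAt.comp (g := F) p.2 hF.hasFDerivAt (hasFDerivAt_prodMk_right p.1 p.2)).fderiv
  rw [h1, h2]
  simp [← map_add]

lemma deriv_time_eq_of_vlasov {V : 𝔼 → ℝ}
    (hf : ContDiff ℝ 1 (fun p : ℝ × 𝔼 × 𝔼 => f p.1 p.2.1 p.2.2))
    (hVl : ∀ x v, deriv (fun s => f s x v) t₀ + fderiv ℝ (fun y => f t₀ y v) x v
      - fderiv ℝ (fun w => f t₀ x w) v (gradient V x) = 0) (p : 𝔼 × 𝔼) :
    deriv (fun s => f s p.1 p.2) t₀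
      = -fderiv ℝ (fun p : 𝔼 × 𝔼 => f t₀ p.1 p.2) p (p.2, -gradient V p.1) := by
  have hF : ContDiff ℝ 1 (fun p : 𝔼 × 𝔼 => f t₀ p.1 p.2) :=
    hf.comp (contDiff_const.prodMk contDiff_id)
  rw [fderiv_phase_apply (hF.differentiable one_ne_zero p), map_neg]
  linarith [hVl p.1 p.2]

lemma integral_mul_deriv_time_of_vlasov {V : 𝔼 → ℝ}
    (hf : ContDiff ℝ 1 (fun p : ℝ × 𝔼 × 𝔼 => f p.1 p.2.1 p.2.2))
    (hC : IsCompact C) (hfC : ∀ t x v, x ∉ C ∨ v ∉ C → f t x v = 0) (hV : ContDiff ℝ 1 V)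
    (hVl : ∀ x v, deriv (fun s => f s x v) t₀ + fderiv ℝ (fun y => f t₀ y v) x v
      - fderiv ℝ (fun w => f t₀ x w) v (gradient V x) = 0)
    {φ : 𝔼 × 𝔼 → ℝ} (hφ : ContDiff ℝ 1 φ) :
    ∫ p : 𝔼 × 𝔼, φ p * deriv (fun s => f s p.1 p.2) t₀
      = ∫ p : 𝔼 × 𝔼, fderiv ℝ φ p (p.2, -gradient V p.1) * f t₀ p.1 p.2 := by
  have hF : ContDiff ℝ 1 (fun p : 𝔼 × 𝔼 => f t₀ p.1 p.2) :=
    hf.comp (contDiff_const.prodMk contDiff_id)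
  have hc : HasCompactSupport (fun p : 𝔼 × 𝔼 => f t₀ p.1 p.2) :=
    HasCompactSupport.intro (hC.prod hC) fun p hp => hfC _ _ _ (not_and_or.1 hp)
  have h := integral_mul_fderiv_transport hφ hF hc (continuous_gradient hV)
  simp_rw [deriv_time_eq_of_vlasov hf hVl, mul_neg]
  rw [integral_neg, h, neg_neg]

lemma hasDerivAt_moment_of_vlasov {V : 𝔼 → ℝ}
    (hf : ContDiff ℝ 1 (fun p : ℝ × 𝔼 × 𝔼 => f p.1 p.2.1 p.2.2))
    (hC : IsCompact C) (hfC : ∀ t x v, x ∉ C ∨ v ∉ C → f t x v = 0) (hV : ContDiff ℝ 1 V)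
    (hVl : ∀ x v, deriv (fun s => f s x v) t₀ + fderiv ℝ (fun y => f t₀ y v) x v
      - fderiv ℝ (fun w => f t₀ x w) v (gradient V x) = 0)
    {φ : 𝔼 × 𝔼 → ℝ} (hφ : ContDiff ℝ 1 φ) :
    HasDerivAt (fun t => ∫ p : 𝔼 × 𝔼, φ p * f t p.1 p.2)
      (∫ p : 𝔼 × 𝔼, fderiv ℝ φ p (p.2, -gradient V p.1) * f t₀ p.1 p.2) t₀ := by
  rw [← integral_mul_deriv_time_of_vlasov hf hC hfC hV hVl hφ]
  exact hasDerivAt_integral_weight_mul (μ := volume) (g := fun t (p : 𝔼 × 𝔼) => f t p.1 p.2)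
    hφ.continuous.locallyIntegrable hf (hC.prod hC) one_pos
    fun s _ p hp => hfC _ _ _ (not_and_or.1 hp)

/-- Evolution of the second moments and of the potential energy along the Vlasov–Poisson flow. -/
lemma hasDerivAt_moments_of_vlasovPoisson
    (hf : ContDiff ℝ 1 (fun p : ℝ × 𝔼 × 𝔼 => f p.1 p.2.1 p.2.2))
    (hC : IsCompact C) (hfC : ∀ t x v, x ∉ C ∨ v ∉ C → f t x v = 0)
    (hVl : ∀ x v, deriv (fun s => f s x v) t₀ + fderiv ℝ (fun y => f t₀ y v) x v
      - fderiv ℝ (fun w => f t₀ x w) v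
        (gradient (logPotential fun y => ∫ w, f t₀ y w) x) = 0) :
    DifferentiableAt ℝ (fun t => ∫ p : 𝔼 × 𝔼, ‖p.2‖ ^ 2 * f t p.1 p.2) t₀ ∧
    HasDerivAt (fun t => (∫ p : 𝔼 × 𝔼, ‖p.2‖ ^ 2 * f t p.1 p.2)
        + ∫ x, logPotential (fun y => ∫ v, f t y v) x * ∫ v, f t x v) 0 t₀ ∧
    HasDerivAt (fun t => ∫ p : 𝔼 × 𝔼, inner ℝ p.1 p.2 * f t p.1 p.2)
      ((∫ p : 𝔼 × 𝔼, ‖p.2‖ ^ 2 * f t₀ p.1 p.2)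
        + (∫ p : 𝔼 × 𝔼, f t₀ p.1 p.2) ^ 2 / (4 * π)) t₀ ∧
    HasDerivAt (fun t => ∫ p : 𝔼 × 𝔼, ‖p.1‖ ^ 2 * f t p.1 p.2)
      (2 * ∫ p : 𝔼 × 𝔼, inner ℝ p.1 p.2 * f t₀ p.1 p.2) t₀ := by
  have hρ : ContDiff ℝ 1 (fun p : ℝ × 𝔼 => ∫ v, f p.1 p.2 v) :=
    contDiff_integral_velocity hf hC fun t x v hv => hfC t x v (Or.inr hv)
  have hρt : ContDiff ℝ 1 (fun y => ∫ w, f t₀ y w) := hρ.comp (contDiff_const.prodMk contDiff_id)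
  have hρC : ∀ t, ∀ x ∉ C, ∫ v, f t x v = 0 := fun t x hx => by
    simp [hfC t x _ (Or.inl hx)]
  have hρc : HasCompactSupport (fun y => ∫ w, f t₀ y w) := HasCompactSupport.intro hC (hρC t₀)
  have hV := contDiff_logPotential hρt hρc
  have hvir := integral_fderiv_logPotential_self_mul hρt hρc
  set V := logPotential fun y => ∫ w, f t₀ y w with hVdef
  have hF : ContDiff ℝ 1 (fun p : 𝔼 × 𝔼 => f t₀ p.1 p.2) :=
    hf.comp (contDiff_const.prodMk contDiff_id)
  have hVd : ∀ y, DifferentiableAt ℝ V y := hV.differentiable one_ne_zero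
  have hdV : Continuous (fderiv ℝ V) := hV.continuous_fderiv one_ne_zero
  have moment := fun (φ : 𝔼 × 𝔼 → ℝ) (hφ : ContDiff ℝ 1 φ) =>
    hasDerivAt_moment_of_vlasov (t₀ := t₀) hf hC hfC hV hVl hφ
  have hgi : ∀ x y, inner ℝ y (gradient V x) = fderiv ℝ V x y := fun x y => by
    rw [real_inner_comm, inner_gradient_left]
  have hmass : ∫ x, ∫ v, f t₀ x v = ∫ p : 𝔼 × 𝔼, f t₀ p.1 p.2 := by
    simpa using integral_mul_integral_velocity (φ := fun _ => 1) hF.continuous hC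
      (hfC t₀) continuous_const
  have hint : ∀ φ : 𝔼 × 𝔼 → ℝ, Continuous φ →
      Integrable (fun p : 𝔼 × 𝔼 => φ p * f t₀ p.1 p.2) := fun φ hφ =>
    integrable_of_zero_off_compact (hφ.mul hF.continuous) (hC.prod hC) fun p hp => by
      simp [hfC t₀ _ _ (not_and_or.1 hp)]
  refine ⟨(moment (fun p => ‖p.2‖ ^ 2) (contDiff_snd.norm_sq ℝ)).differentiableAt, ?_, ?_, ?_⟩
  · have d1 := moment (fun p => ‖p.2‖ ^ 2) (contDiff_snd.norm_sq ℝ)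
    have e1 : ∀ p : 𝔼 × 𝔼, fderiv ℝ (fun p : 𝔼 × 𝔼 => ‖p.2‖ ^ 2) p (p.2, -gradient V p.1)
        = -2 * fderiv ℝ V p.1 p.2 := by
      intro p
      simp_rw [← real_inner_self_eq_norm_sq]
      rw [fderiv_inner_apply ℝ differentiableAt_snd differentiableAt_snd]
      simp only [fderiv_snd, ContinuousLinearMap.coe_snd', inner_neg_left, inner_neg_right, hgi]
      rw [inner_gradient_left]
      ring
    simp_rw [e1, mul_assoc] at d1
    rw [integral_const_mul] at d1
    have d2 := hasDerivAt_integral_logPotential_mul (t₀ := t₀) hρ hC one_pos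
      fun s _ x hx => hρC s x hx
    have e2 : ∀ x, deriv (fun s => ∫ v, f s x v) t₀ = ∫ v, deriv (fun s => f s x v) t₀ := by
      intro x
      have h := hasDerivAt_integral_weight_mul (μ := (volume : Measure 𝔼)) (w := fun _ => 1)
        (g := fun t v => f t x v) (t₀ := t₀) continuous_const.locallyIntegrable
        (hf.comp (f := fun q : ℝ × 𝔼 => (q.1, x, q.2)) (by fun_prop)) hC one_pos
        fun s _ v hv => hfC s x v (Or.inr hv)
      simpa using h.deriv
    have hdt : Continuous (fun p : 𝔼 × 𝔼 => deriv (fun s => f s p.1 p.2) t₀) :=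
      (continuous_partial_deriv (g := fun t (p : 𝔼 × 𝔼) => f t p.1 p.2) hf).comp
        (continuous_const.prodMk continuous_id)
    have e3 := integral_mul_integral_velocity (g := fun x v => deriv (fun s => f s x v) t₀) hdt hC
      (fun x v h => by simp [hfC _ x v h]) hV.continuous
    have e4 := integral_mul_deriv_time_of_vlasov hf hC hfC hV hVl
      (φ := fun p : 𝔼 × 𝔼 => V p.1) (hV.comp contDiff_fst)
    have e5 : ∀ p : 𝔼 × 𝔼, fderiv ℝ (fun p : 𝔼 × 𝔼 => V p.1) p (p.2, -gradient V p.1)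
        = fderiv ℝ V p.1 p.2 := by
      intro p
      have h : fderiv ℝ (fun p : 𝔼 × 𝔼 => V p.1) p = _ :=
        (HasFDerivAt.comp (g := V) p (hVd p.1).hasFDerivAt hasFDerivAt_fst).fderiv
      rw [h]
      simp
    simp_rw [e2] at d2
    rw [← hVdef, e3, e4] at d2
    simp_rw [e5] at d2
    refine (d1.add d2).congr_deriv ?_
    ring
  · refine (moment (fun p => inner ℝ p.1 p.2) (contDiff_fst.inner ℝ contDiff_snd)).congr_deriv ?_
    have e1 : ∀ p : 𝔼 × 𝔼, fderiv ℝ (fun p : 𝔼 × 𝔼 => inner ℝ p.1 p.2) p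
        (p.2, -gradient V p.1) = ‖p.2‖ ^ 2 - fderiv ℝ V p.1 p.1 := by
      intro p
      rw [fderiv_inner_apply ℝ differentiableAt_fst differentiableAt_snd]
      simp only [fderiv_snd, fderiv_fst, ContinuousLinearMap.coe_snd',
        ContinuousLinearMap.coe_fst', inner_neg_right, hgi, real_inner_self_eq_norm_sq]
      ring
    have e2 := integral_mul_integral_velocity (φ := fun x => fderiv ℝ V x x) hF.continuous hC
      (hfC t₀) (hdV.clm_apply continuous_id)
    simp_rw [e1, sub_mul]
    rw [integral_sub (hint _ (by fun_prop)) (hint (fun p => fderiv ℝ V p.1 p.1) (by fun_prop)),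
      ← e2, hvir, hmass]
    ring
  · refine (moment (fun p => ‖p.1‖ ^ 2) (contDiff_fst.norm_sq ℝ)).congr_deriv ?_
    have e1 : ∀ p : 𝔼 × 𝔼, fderiv ℝ (fun p : 𝔼 × 𝔼 => ‖p.1‖ ^ 2) p (p.2, -gradient V p.1)
        = 2 * inner ℝ p.1 p.2 := by
      intro p
      simp_rw [← real_inner_self_eq_norm_sq]
      rw [fderiv_inner_apply ℝ differentiableAt_fst differentiableAt_fst]
      simp only [fderiv_fst, ContinuousLinearMap.coe_fst']
      rw [real_inner_comm p.1 p.2]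
      ring
    simp_rw [e1, mul_assoc]
    rw [integral_const_mul]

end Moments

section LowerBound

lemma log_norm_le_of_pos {x : 𝔼} (hx : x ≠ 0) {a : ℝ} (ha : 0 < a) :
    Real.log ‖x‖ ≤ (‖x‖ ^ 2 / a - 1 + Real.log a) / 2 := by
  have h0 : 0 < ‖x‖ := norm_pos_iff.2 hx
  have h := Real.log_le_sub_one_of_pos (x := ‖x‖ ^ 2 / a) (by positivity)
  rw [Real.log_div (by positivity) ha.ne', Real.log_pow] at h
  push_cast at h
  linarith

lemma integral_logPotential_mul_self_ge {r : 𝔼 → ℝ} (hr : ContDiff ℝ 1 r)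
    (hc : HasCompactSupport r) (hr0 : ∀ x, 0 ≤ r x) {a : ℝ} (ha : 0 < a) :
    -(1 / (4 * π)) * (2 * (∫ x, r x) * (∫ x, ‖x‖ ^ 2 * r x) / a
      + (∫ x, r x) ^ 2 * (Real.log a - 1)) ≤ ∫ x, logPotential r x * r x := by
  have hrc := hr.continuous
  have hint : ∀ φ : 𝔼 → ℝ, Continuous φ → Integrable (fun x => φ x * r x) := fun φ hφ =>
    (hφ.mul hrc).integrable_of_hasCompactSupport hc.mul_left
  have hir : Integrable r := hrc.integrable_of_hasCompactSupport hc
  have hiv : Integrable (fun y => r y • y) :=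
    (hrc.smul continuous_id).integrable_of_hasCompactSupport hc.smul_right
  have hπ := Real.pi_pos
  set m := ∫ x, r x with hm
  set I := ∫ x, ‖x‖ ^ 2 * r x with hI
  set b := ∫ y, r y • y with hb
  have hinner : ∀ x, ∫ y, inner ℝ x y * r y = inner ℝ x b := by
    intro x
    rw [hb, ← integral_inner hiv]
    congr 1; ext y
    rw [inner_smul_right, mul_comm]
  have hpt : ∀ x, -(1 / (4 * π)) * ((m * ‖x‖ ^ 2 - 2 * inner ℝ x b + I) / a
      + m * (Real.log a - 1)) ≤ logPotential r x := by
    intro x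
    have hne : ∀ᵐ y : 𝔼, y ≠ x := by simp [ae_iff, measure_singleton]
    have h1 : ∫ y, Real.log ‖x - y‖ * r y
        ≤ ∫ y, (‖x - y‖ ^ 2 / a - 1 + Real.log a) / 2 * r y := by
      refine integral_mono_ae (integrable_log_norm_sub_mul hrc hc x) (hint _ (by fun_prop))
        (hne.mono fun y hy => ?_)
      exact mul_le_mul_of_nonneg_right (log_norm_le_of_pos (sub_ne_zero.2 hy.symm) ha) (hr0 y)
    have h2 : ∀ y, (‖x - y‖ ^ 2 / a - 1 + Real.log a) / 2 * r y
        = (‖x‖ ^ 2 / a - 1 + Real.log a) / 2 * r y - a⁻¹ * (inner ℝ x y * r y)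
          + (2 * a)⁻¹ * (‖y‖ ^ 2 * r y) := by
      intro y
      rw [norm_sub_sq_real]
      field_simp
      ring
    simp_rw [h2] at h1
    rw [integral_add, integral_sub, integral_const_mul, integral_const_mul, integral_const_mul,
      hinner, ← hm, ← hI] at h1
    · have h3 : -(1 / (4 * π)) * ((m * ‖x‖ ^ 2 - 2 * inner ℝ x b + I) / a
          + m * (Real.log a - 1)) = -(1 / (2 * π)) * ((‖x‖ ^ 2 / a - 1 + Real.log a) / 2 * m
            - a⁻¹ * inner ℝ x b + (2 * a)⁻¹ * I) := by
        field_simp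
        ring
      rw [h3]
      simp only [logPotential]
      exact mul_le_mul_of_nonpos_left h1 (by rw [neg_nonpos]; positivity)
    · exact hir.const_mul _
    · exact (hint _ (by fun_prop)).const_mul _
    · exact (hir.const_mul _).sub ((hint _ (by fun_prop)).const_mul _)
    · exact (hint _ (by fun_prop)).const_mul _
  have hb2 : ∫ x, inner ℝ x b * r x = ‖b‖ ^ 2 := by
    simp_rw [real_inner_comm b]
    rw [hinner, real_inner_self_eq_norm_sq]
  have h1 : ∫ x, -(1 / (4 * π)) * ((m * ‖x‖ ^ 2 - 2 * inner ℝ x b + I) / a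
      + m * (Real.log a - 1)) * r x ≤ ∫ x, logPotential r x * r x :=
    integral_mono (hint _ (by fun_prop)) (hint _ (contDiff_logPotential hr hc).continuous)
      fun x => mul_le_mul_of_nonneg_right (hpt x) (hr0 x)
  have h2 : ∀ x, -(1 / (4 * π)) * ((m * ‖x‖ ^ 2 - 2 * inner ℝ x b + I) / a
      + m * (Real.log a - 1)) * r x
      = -(1 / (4 * π)) * (m / a) * (‖x‖ ^ 2 * r x) + 1 / (4 * π) * (2 / a) * (inner ℝ x b * r x)
        + -(1 / (4 * π)) * (I / a + m * (Real.log a - 1)) * r x := by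
    intro x
    ring
  simp_rw [h2] at h1
  rw [integral_add, integral_add, integral_const_mul, integral_const_mul, integral_const_mul,
    hb2, ← hm, ← hI] at h1
  · refine le_trans ?_ h1
    have h3 : 0 ≤ 1 / (4 * π) * (2 / a) * ‖b‖ ^ 2 := by positivity
    have h4 : -(1 / (4 * π)) * (2 * m * I / a + m ^ 2 * (Real.log a - 1))
        = -(1 / (4 * π)) * (m / a) * I
          + -(1 / (4 * π)) * (I / a + m * (Real.log a - 1)) * m := by
      ring
    linarith
  · exact (hint _ (by fun_prop)).const_mul _
  · exact (hint _ (by fun_prop)).const_mul _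
  · exact ((hint _ (by fun_prop)).const_mul _).add ((hint _ (by fun_prop)).const_mul _)
  · exact hir.const_mul _

end LowerBound

section Cutoff

variable {f : ℝ → 𝔼 → 𝔼 → ℝ}

lemma exists_cutoff_phase_space (hf : ContDiff ℝ 1 (fun p : ℝ × 𝔼 × 𝔼 => f p.1 p.2.1 p.2.2))
    {T K : ℝ} (hK : ∀ t ∈ Icc (0 : ℝ) T, ∀ x v, (K ≤ ‖x‖ ∨ K ≤ ‖v‖) → f t x v = 0) :
    ∃ (g : ℝ → 𝔼 → 𝔼 → ℝ) (C : Set 𝔼),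
      ContDiff ℝ 1 (fun p : ℝ × 𝔼 × 𝔼 => g p.1 p.2.1 p.2.2) ∧ IsCompact C ∧
      (∀ t x v, x ∉ C ∨ v ∉ C → g t x v = 0) ∧ ∀ t ∈ Icc (0 : ℝ) T, g t = f t := by
  let χ : ContDiffBump (0 : 𝔼) :=
    { rIn := |K| + 1, rOut := |K| + 2, rIn_pos := by positivity, rIn_lt_rOut := by linarith }
  have hχ : ContDiff ℝ 1 χ := χ.contDiff
  refine ⟨fun t x v => χ x * χ v * f t x v, Metric.closedBall 0 (|K| + 2), ?_,
    isCompact_closedBall _ _, ?_, ?_⟩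
  · exact ((hχ.comp (contDiff_fst.comp contDiff_snd)).mul
      (hχ.comp (contDiff_snd.comp contDiff_snd))).mul hf
  · have h : ∀ x ∉ Metric.closedBall (0 : 𝔼) (|K| + 2), χ x = 0 := fun x hx =>
      χ.zero_of_le_dist (not_le.1 fun h => hx h).le
    rintro t x v (hx | hv)
    · simp [h x hx]
    · simp [h v hv]
  · intro t ht
    ext x v
    by_cases hx : K ≤ ‖x‖ ∨ K ≤ ‖v‖
    · simp [hK t ht x v hx]
    · push Not at hx
      have h : ∀ y : 𝔼, ‖y‖ < K → χ y = 1 := fun y hy =>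
        χ.one_of_mem_closedBall (by
          rw [mem_closedBall_zero_iff]
          exact (hy.le.trans (le_abs_self K)).trans (by simp [χ]))
      simp [h x hx.1, h v hx.2]

lemma hasDerivWithinAt_moments_of_vlasovPoisson
    (hf : ContDiff ℝ 1 (fun p : ℝ × 𝔼 × 𝔼 => f p.1 p.2.1 p.2.2))
    (hsupp : ∀ T₀ : ℝ, ∃ K₀ : ℝ, ∀ t ∈ Icc (0 : ℝ) T₀, ∀ x v,
      (K₀ ≤ ‖x‖ ∨ K₀ ≤ ‖v‖) → f t x v = 0)
    {t₀ : ℝ} (ht₀ : 0 ≤ t₀)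
    (hVl : ∀ x v, deriv (fun s => f s x v) t₀ + fderiv ℝ (fun y => f t₀ y v) x v
      - fderiv ℝ (fun w => f t₀ x w) v
        (gradient (logPotential fun y => ∫ w, f t₀ y w) x) = 0) :
    ContinuousWithinAt (fun t => ∫ p : 𝔼 × 𝔼, ‖p.2‖ ^ 2 * f t p.1 p.2) (Ici 0) t₀ ∧
    HasDerivWithinAt (fun t => (∫ p : 𝔼 × 𝔼, ‖p.2‖ ^ 2 * f t p.1 p.2)
        + ∫ x, logPotential (fun y => ∫ v, f t y v) x * ∫ v, f t x v) 0 (Ici 0) t₀ ∧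
    HasDerivWithinAt (fun t => ∫ p : 𝔼 × 𝔼, inner ℝ p.1 p.2 * f t p.1 p.2)
      ((∫ p : 𝔼 × 𝔼, ‖p.2‖ ^ 2 * f t₀ p.1 p.2)
        + (∫ p : 𝔼 × 𝔼, f t₀ p.1 p.2) ^ 2 / (4 * π)) (Ici 0) t₀ ∧
    HasDerivWithinAt (fun t => ∫ p : 𝔼 × 𝔼, ‖p.1‖ ^ 2 * f t p.1 p.2)
      (2 * ∫ p : 𝔼 × 𝔼, inner ℝ p.1 p.2 * f t₀ p.1 p.2) (Ici 0) t₀ := by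
  obtain ⟨K, hK⟩ := hsupp (t₀ + 1)
  obtain ⟨g, C, hg, hC, hgC, hgf⟩ := exists_cutoff_phase_space hf hK
  have ht : t₀ ∈ Icc (0 : ℝ) (t₀ + 1) := ⟨ht₀, by linarith⟩
  have hnear : ∀ᶠ t in 𝓝[Ici 0] t₀, g t = f t := by
    have h1 : ∀ᶠ t in 𝓝[Ici 0] t₀, t < t₀ + 1 :=
      nhdsWithin_le_nhds (Iio_mem_nhds (by linarith))
    filter_upwards [h1, self_mem_nhdsWithin] with t h1 h2
    exact hgf t ⟨h2, h1.le⟩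
  have hdt : ∀ x v, deriv (fun s => g s x v) t₀ = deriv (fun s => f s x v) t₀ := by
    intro x v
    have h1 := (hasDerivAt_partial (g := fun t (p : 𝔼 × 𝔼) => g t p.1 p.2) hg t₀
      (x, v)).hasDerivWithinAt (s := Ici 0)
    have h2 := (hasDerivAt_partial (g := fun t (p : 𝔼 × 𝔼) => f t p.1 p.2) hf t₀
      (x, v)).hasDerivWithinAt (s := Ici 0)
    have h3 := h2.congr_of_eventuallyEq (hnear.mono fun t h => by simp only [h])
      (f₁ := fun s => g s x v) (by simp only [hgf t₀ ht])
    exact (uniqueDiffOn_Ici (0 : ℝ) t₀ ht₀).eq_deriv _ h1 h3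
  have hVl' : ∀ x v, deriv (fun s => g s x v) t₀ + fderiv ℝ (fun y => g t₀ y v) x v
      - fderiv ℝ (fun w => g t₀ x w) v
        (gradient (logPotential fun y => ∫ w, g t₀ y w) x) = 0 := by
    intro x v
    rw [hdt, hgf t₀ ht]
    exact hVl x v
  obtain ⟨d0, d1, d2, d3⟩ := hasDerivAt_moments_of_vlasovPoisson hg hC hgC hVl'
  rw [hgf t₀ ht] at d2 d3
  refine ⟨?_, ?_, ?_, ?_⟩
  · exact d0.continuousAt.continuousWithinAt.congr_of_eventuallyEq
      (hnear.mono fun t h => by simp only [h]) (by simp only [hgf t₀ ht])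
  · exact d1.hasDerivWithinAt.congr_of_eventuallyEq (hnear.mono fun t h => by simp only [h])
      (by simp only [hgf t₀ ht])
  · exact d2.hasDerivWithinAt.congr_of_eventuallyEq (hnear.mono fun t h => by simp only [h])
      (by simp only [hgf t₀ ht])
  · exact d3.hasDerivWithinAt.congr_of_eventuallyEq (hnear.mono fun t h => by simp only [h])
      (by simp only [hgf t₀ ht])

end Cutoff

section Slices

variable {g : 𝔼 → 𝔼 → ℝ} {C : Set 𝔼}

lemma contDiff_velocity_average (hg : ContDiff ℝ 1 (fun p : 𝔼 × 𝔼 => g p.1 p.2))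
    (hC : IsCompact C) (hgC : ∀ x v, x ∉ C ∨ v ∉ C → g x v = 0) :
    ContDiff ℝ 1 (fun x => ∫ v, g x v) := by
  have h := contDiff_integral_velocity (f := fun _ => g) (hg.comp contDiff_snd) hC
    fun _ x v hv => hgC x v (Or.inr hv)
  exact h.comp (f := fun x : 𝔼 => ((0 : ℝ), x)) (contDiff_const.prodMk contDiff_id)

lemma integral_norm_sub_smul_sq_mul (hg : Continuous (fun p : 𝔼 × 𝔼 => g p.1 p.2))
    (hC : IsCompact C) (hgC : ∀ x v, x ∉ C ∨ v ∉ C → g x v = 0) (h : ℝ) :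
    ∫ p : 𝔼 × 𝔼, ‖p.2 - h • p.1‖ ^ 2 * g p.1 p.2
      = (∫ p : 𝔼 × 𝔼, ‖p.2‖ ^ 2 * g p.1 p.2) - 2 * h * (∫ p : 𝔼 × 𝔼, inner ℝ p.1 p.2 * g p.1 p.2)
        + h ^ 2 * ∫ p : 𝔼 × 𝔼, ‖p.1‖ ^ 2 * g p.1 p.2 := by
  have hint : ∀ φ : 𝔼 × 𝔼 → ℝ, Continuous φ →
      Integrable (fun p : 𝔼 × 𝔼 => φ p * g p.1 p.2) := fun φ hφ =>
    integrable_of_zero_off_compact (hφ.mul hg) (hC.prod hC) fun p hp => by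
      simp [hgC _ _ (not_and_or.1 hp)]
  have e : ∀ p : 𝔼 × 𝔼, ‖p.2 - h • p.1‖ ^ 2 * g p.1 p.2
      = ‖p.2‖ ^ 2 * g p.1 p.2 - 2 * h * (inner ℝ p.1 p.2 * g p.1 p.2)
        + h ^ 2 * (‖p.1‖ ^ 2 * g p.1 p.2) := by
    intro p
    rw [norm_sub_sq_real, inner_smul_right, norm_smul, mul_pow, Real.norm_eq_abs, sq_abs,
      real_inner_comm]
    ring
  have i1 := hint (fun p => ‖p.2‖ ^ 2) (by fun_prop)
  have i2 := (hint (fun p => inner ℝ p.1 p.2) (by fun_prop)).const_mul (2 * h)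
  have i3 := (hint (fun p => ‖p.1‖ ^ 2) (by fun_prop)).const_mul (h ^ 2)
  simp_rw [e]
  rw [integral_add, integral_sub i1 i2, integral_const_mul, integral_const_mul]
  · exact i1.sub i2
  · exact i3

lemma potential_energy_add_confinement_ge (hg : ContDiff ℝ 1 (fun p : 𝔼 × 𝔼 => g p.1 p.2))
    (hC : IsCompact C) (hgC : ∀ x v, x ∉ C ∨ v ∉ C → g x v = 0) (hg0 : ∀ x v, 0 ≤ g x v)
    {M : ℝ} (hM : 0 < M) (hmass : ∫ p : 𝔼 × 𝔼, g p.1 p.2 = M) {R : ℝ} (hR : 0 < R) :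
    M ^ 2 / (4 * π) * (1 - Real.log (M / (2 * π)))
      ≤ (∫ x, logPotential (fun y => ∫ v, g y v) x * ∫ v, g x v)
        + (R ^ 2)⁻¹ * (∫ x, ‖x‖ ^ 2 * ∫ v, g x v) + M ^ 2 / (2 * π) * Real.log R := by
  have hπ := Real.pi_pos
  have hρ := contDiff_velocity_average hg hC hgC
  have hρc : HasCompactSupport (fun x => ∫ v, g x v) :=
    HasCompactSupport.intro hC fun x hx => by simp [hgC x _ (Or.inl hx)]
  have hm : ∫ x, ∫ v, g x v = M := by
    rw [← hmass]
    simpa using integral_mul_integral_velocity (φ := fun _ => 1) hg.continuous hC hgC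
      continuous_const
  have h := integral_logPotential_mul_self_ge hρ hρc
    (fun x => integral_nonneg (hg0 x)) (a := M / (2 * π) * R ^ 2) (by positivity)
  rw [hm, Real.log_mul (by positivity) (by positivity), Real.log_pow] at h
  push_cast at h
  have e : -(1 / (4 * π)) * (2 * M * (∫ x, ‖x‖ ^ 2 * ∫ v, g x v) / (M / (2 * π) * R ^ 2)
      + M ^ 2 * (Real.log (M / (2 * π)) + 2 * Real.log R - 1))
      = M ^ 2 / (4 * π) * (1 - Real.log (M / (2 * π)))
        - (R ^ 2)⁻¹ * (∫ x, ‖x‖ ^ 2 * ∫ v, g x v) - M ^ 2 / (2 * π) * Real.log R := by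
    field_simp
    ring
  linarith

end Slices

lemma integrableOn_Ici_of_hasDerivWithinAt_nonneg {L k : ℝ → ℝ} {c : ℝ}
    (hk : ContinuousOn k (Ici 0)) (hk0 : ∀ t, 0 ≤ t → 0 ≤ k t)
    (hL : ∀ t, 0 ≤ t → HasDerivWithinAt L (-2 * k t) (Ici 0) t) (hc : ∀ t, 0 ≤ t → c ≤ L t) :
    IntegrableOn k (Ici 0) := by
  rw [integrableOn_Ici_iff_integrableOn_Ioi]
  refine integrableOn_Ioi_of_intervalIntegral_norm_bounded ((L 0 - c) / 2) 0 (b := id)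
    (l := Filter.atTop) (fun b => ?_) Filter.tendsto_id ?_
  · exact ((hk.mono Icc_subset_Ici_self).integrableOn_Icc).mono_set Ioc_subset_Icc_self
  · filter_upwards [Filter.eventually_ge_atTop 0] with b hb
    have hb' : (0 : ℝ) ≤ b := hb
    have hint : IntervalIntegrable (fun t => -2 * k t) volume 0 b := by
      refine ContinuousOn.intervalIntegrable ?_
      rw [uIcc_of_le hb']
      exact (continuousOn_const.mul hk).mono Icc_subset_Ici_self
    have h := intervalIntegral.integral_eq_sub_of_hasDerivAt_of_le hb'
      (fun t ht => ((hL t ht.1).continuousWithinAt).mono Icc_subset_Ici_self)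
      (fun t ht => (hL t ht.1.le).hasDerivAt (Ici_mem_nhds ht.1)) hint
    rw [intervalIntegral.integral_const_mul] at h
    have h2 : ∫ t in (0 : ℝ)..b, ‖k t‖ = ∫ t in (0 : ℝ)..b, k t := by
      refine intervalIntegral.integral_congr fun t ht => ?_
      rw [uIcc_of_le hb'] at ht
      exact Real.norm_of_nonneg (hk0 t ht.1)
    simp only [id]
    rw [h2]
    linarith [hc b hb']

/-- Lyapunov functional for the 2-dimensional Vlasov–Poisson system in the
plasma case `ε = −1`:
`L(t) = ∬ |v-(Ṙ/R)x|² f + ∫ Uρ + R^{-2} ∫ |x|² ρ + (M²/2π) log R` satisfies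
`L' = −2(Ṙ/R)K ≤ 0`, `L(t) ≥ (M²/4π)(1 − log(M/2π))`, and `∫_0^∞ (Ṙ/R) K < ∞`. -/
theorem stmt1
    (f : ℝ → EuclideanSpace ℝ (Fin 2) → EuclideanSpace ℝ (Fin 2) → ℝ)
    (ρ U : ℝ → EuclideanSpace ℝ (Fin 2) → ℝ)
    (R K L : ℝ → ℝ) (M : ℝ) (hM : 0 < M)
    -- spatial density and logarithmic potential
    (hρ : ∀ t x, ρ t x = ∫ v, f t x v)
    (hU : ∀ t x, U t x = -(1 / (2 * π)) * ∫ y, Real.log ‖x - y‖ * ρ t y)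
    -- the rescaling function: `R̈ = 1/R`, `R(0)=1`, `Ṙ(0)=0`
    (hR : ContDiff ℝ 2 R) (hR0 : R 0 = 1) (hR'0 : deriv R 0 = 0)
    (hRpos : ∀ t : ℝ, 0 ≤ t → 0 < R t)
    (hRode : ∀ t : ℝ, 0 ≤ t → deriv (deriv R) t = (R t)⁻¹)
    -- `f` is a nonnegative C¹ solution, compactly supported in `(x,v)` locally
    -- uniformly in `t`, with total mass `M`
    (hf_C1 : ContDiff ℝ 1 (fun p : ℝ × EuclideanSpace ℝ (Fin 2) × EuclideanSpace ℝ (Fin 2) =>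
      f p.1 p.2.1 p.2.2))
    (hf_nonneg : ∀ t x v, 0 ≤ f t x v)
    (hf_supp : ∀ T₀ : ℝ, ∃ K₀ : ℝ, ∀ t ∈ Icc (0 : ℝ) T₀, ∀ x v,
      (K₀ ≤ ‖x‖ ∨ K₀ ≤ ‖v‖) → f t x v = 0)
    (hf_mass : ∀ t : ℝ, 0 ≤ t →
      (∫ p : EuclideanSpace ℝ (Fin 2) × EuclideanSpace ℝ (Fin 2), f t p.1 p.2) = M)
    -- the Vlasov equation `∂_t f + v·∇_x f − ∇_x U·∇_v f = 0`
    (hVlasov : ∀ t : ℝ, 0 ≤ t → ∀ x v,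
      deriv (fun s => f s x v) t
        + fderiv ℝ (fun y => f t y v) x v
        - fderiv ℝ (fun w => f t x w) v (gradient (fun y => U t y) x) = 0)
    -- kinetic term and Lyapunov functional
    (hK : ∀ t, K t = ∫ p : EuclideanSpace ℝ (Fin 2) × EuclideanSpace ℝ (Fin 2),
      ‖p.2 - (deriv R t / R t) • p.1‖ ^ 2 * f t p.1 p.2)
    (hL : ∀ t, L t = K t + (∫ x, U t x * ρ t x)
      + (R t ^ 2)⁻¹ * (∫ x, ‖x‖ ^ 2 * ρ t x)
      + (M ^ 2 / (2 * π)) * Real.log (R t)) :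
    (∀ t : ℝ, 0 ≤ t →
      HasDerivWithinAt L (-2 * (deriv R t / R t) * K t) (Ici 0) t ∧
      -2 * (deriv R t / R t) * K t ≤ 0) ∧
    (∀ t : ℝ, 0 ≤ t → (M ^ 2 / (4 * π)) * (1 - Real.log (M / (2 * π))) ≤ L t) ∧
    IntegrableOn (fun s => (deriv R s / R s) * K s) (Ici 0) := by
  have hρ' : ρ = fun t x => ∫ v, f t x v := by
    ext t x
    exact hρ t x
  have hU' : U = fun t => logPotential (fun y => ∫ v, f t y v) := by
    ext t x
    rw [hU, hρ']
    rfl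
  subst hρ' hU'
  have hFt : ∀ t, ContDiff ℝ 1 (fun p : 𝔼 × 𝔼 => f t p.1 p.2) := fun t =>
    hf_C1.comp (contDiff_const.prodMk contDiff_id)
  have hC : ∀ t, 0 ≤ t → ∃ C : Set 𝔼, IsCompact C ∧ ∀ x v, x ∉ C ∨ v ∉ C → f t x v = 0 := by
    intro t ht
    obtain ⟨K₀, hK₀⟩ := hf_supp t
    refine ⟨Metric.closedBall 0 K₀, isCompact_closedBall _ _, fun x v h => ?_⟩
    refine hK₀ t ⟨ht, le_rfl⟩ x v (h.imp ?_ ?_) <;>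
    · intro h
      rw [mem_closedBall_zero_iff, not_le] at h
      exact h.le
  set A : ℝ → ℝ := fun t => ∫ p : 𝔼 × 𝔼, ‖p.2‖ ^ 2 * f t p.1 p.2 with hA
  set B : ℝ → ℝ := fun t => ∫ p : 𝔼 × 𝔼, inner ℝ p.1 p.2 * f t p.1 p.2 with hB
  set I : ℝ → ℝ := fun t => ∫ p : 𝔼 × 𝔼, ‖p.1‖ ^ 2 * f t p.1 p.2 with hI
  set P : ℝ → ℝ := fun t => ∫ x, logPotential (fun y => ∫ v, f t y v) x * ∫ v, f t x v with hP
  have hKexp : ∀ t, 0 ≤ t → K t = A t - 2 * (deriv R t / R t) * B t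
      + (deriv R t / R t) ^ 2 * I t := by
    intro t ht
    obtain ⟨C, hC, hfC⟩ := hC t ht
    rw [hK, integral_norm_sub_smul_sq_mul (hFt t).continuous hC hfC]
  have hIexp : ∀ t, 0 ≤ t → ∫ x, ‖x‖ ^ 2 * ∫ v, f t x v = I t := by
    intro t ht
    obtain ⟨C, hC, hfC⟩ := hC t ht
    exact integral_mul_integral_velocity (φ := fun x => ‖x‖ ^ 2) (hFt t).continuous hC hfC
      (by fun_prop)
  have hLexp : ∀ t, 0 ≤ t → L t = A t + P t - 2 * (deriv R t / R t) * B t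
      + ((deriv R t / R t) ^ 2 + (R t ^ 2)⁻¹) * I t + M ^ 2 / (2 * π) * Real.log (R t) := by
    intro t ht
    rw [hL, hKexp t ht, hIexp t ht]
    ring
  have hK0 : ∀ t, 0 ≤ K t := fun t => by
    rw [hK]
    exact integral_nonneg fun p => mul_nonneg (by positivity) (hf_nonneg t p.1 p.2)
  have hdR : ∀ t, HasDerivAt R (deriv R t) t := fun t =>
    (hR.differentiable two_ne_zero t).hasDerivAt
  have hR' : ContDiff ℝ 1 (deriv R) := by
    have h : ContDiff ℝ (1 + 1) R := by simpa [one_add_one_eq_two] using hR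
    exact (contDiff_succ_iff_deriv.1 h).2.2
  have hddR : ∀ t, 0 ≤ t → HasDerivAt (deriv R) (R t)⁻¹ t := fun t ht => by
    rw [← hRode t ht]
    exact (hR'.differentiable one_ne_zero t).hasDerivAt
  have hR'0 : ∀ t, 0 ≤ t → 0 ≤ deriv R t := by
    have hmono : MonotoneOn (deriv R) (Ici 0) := by
      refine monotoneOn_of_deriv_nonneg (convex_Ici 0) hR'.continuous.continuousOn
        (hR'.differentiable one_ne_zero).differentiableOn fun t ht => ?_
      rw [interior_Ici] at ht
      rw [hRode t (le_of_lt ht)]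
      exact (inv_pos.2 (hRpos t (le_of_lt ht))).le
    intro t ht
    rw [← hR'0]
    exact hmono self_mem_Ici ht ht
  have hdh : ∀ t, 0 ≤ t → HasDerivAt (fun t => deriv R t / R t)
      (((R t)⁻¹ * R t - deriv R t * deriv R t) / R t ^ 2) t := fun t ht =>
    (hddR t ht).div (hdR t) (hRpos t ht).ne'
  have hk0 : ∀ t, 0 ≤ t → 0 ≤ deriv R t / R t * K t := fun t ht =>
    mul_nonneg (div_nonneg (hR'0 t ht) (hRpos t ht).le) (hK0 t)
  have hmom := fun t (ht : 0 ≤ t) =>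
    hasDerivWithinAt_moments_of_vlasovPoisson hf_C1 hf_supp ht (hVlasov t ht)
  have hmain : ∀ t, 0 ≤ t → HasDerivWithinAt L (-2 * (deriv R t / R t * K t)) (Ici 0) t := by
    intro t ht
    obtain ⟨-, d1, d2, d3⟩ := hmom t ht
    rw [hf_mass t ht] at d2
    have hRt := (hRpos t ht).ne'
    have dh := (hdh t ht).hasDerivWithinAt (s := Ici 0)
    have dR := (hdR t).hasDerivWithinAt (s := Ici 0)
    have dL := (((d1.sub ((dh.const_mul 2).mul d2)).add
      (((dh.pow 2).add ((dR.pow 2).inv (pow_ne_zero 2 hRt))).mul d3)).add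
      ((dR.log hRt).const_mul (M ^ 2 / (2 * π))))
    refine (dL.congr (fun s hs => hLexp s hs) (hLexp t ht)).congr_deriv ?_
    rw [hKexp t ht]
    simp only [hA, hB, hI, Pi.add_apply, Pi.pow_apply, Pi.inv_apply, inv_mul_cancel₀ hRt,
      Nat.cast_ofNat, Nat.add_one_sub_one, pow_one]
    field_simp
    ring
  have hlow : ∀ t, 0 ≤ t → M ^ 2 / (4 * π) * (1 - Real.log (M / (2 * π))) ≤ L t := by
    intro t ht
    obtain ⟨C, hC, hfC⟩ := hC t ht
    have h := potential_energy_add_confinement_ge (hFt t) hC hfC (hf_nonneg t) hM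
      (hf_mass t ht) (hRpos t ht)
    rw [hL]
    linarith [hK0 t]
  refine ⟨fun t ht => ⟨(hmain t ht).congr_deriv (by ring), by linarith [hk0 t ht]⟩, hlow, ?_⟩
  refine integrableOn_Ici_of_hasDerivWithinAt_nonneg ?_ hk0 hmain hlow
  intro t ht
  obtain ⟨cA, -, dB, dI⟩ := hmom t ht
  have ch := (hdh t ht).continuousAt.continuousWithinAt (s := Ici 0)
  have cK := (cA.sub ((ch.const_mul 2).mul dB.continuousWithinAt)).add
    ((ch.pow 2).mul dI.continuousWithinAt)
  exact ch.mul (cK.congr (fun s hs => hKexp s hs) (hKexp t ht))
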